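/- Let G be a (possibly infinite) connected graph, w a vertex of G, and T a BFS-tree of G rooted at w. Then G is hyperbolic (i.e., δ(G) is finite) if and only if the rooted insize ρ_{w,T}(G) is finite. -/

import Mathlib

open SimpleGraph

noncomputable section

namespace HypPaper

variable {V : Type*}

/-- Gromov product `(y|z)_w = (d(y,w)+d(z,w)-d(y,z))/2`. -/
def gp (G : SimpleGraph V) (y z w : V) : ℝ :=
  ((G.dist y w : ℝ) + (G.dist z w : ℝ) - (G.dist y z : ℝ)) / 2

/-- `G` is `δ`-hyperbolic. -/
def IsDeltaHyp (G : SimpleGraph V) (δ : ℝ) : Prop :=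
  ∀ w x y z : V, gp G x y w ≥ min (gp G x z w) (gp G y z w) - δ

/-- The hyperbolicity `δ(G)`: least `δ ≥ 0` such that `G` is `δ`-hyperbolic. -/
def hyperbolicity (G : SimpleGraph V) : ℝ :=
  sInf {δ : ℝ | 0 ≤ δ ∧ IsDeltaHyp G δ}

/-- Pointed hyperbolicity `δ_w(G)` with respect to basepoint `w`. -/
def pointedHyp (G : SimpleGraph V) (w : V) : ℝ :=
  sInf {δ : ℝ | ∀ x y z : V, gp G x y w ≥ min (gp G x z w) (gp G y z w) - δ}

/-- A walk is a geodesic (shortest path) if its length equals the distance. -/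
def IsGeodesic (G : SimpleGraph V) {x y : V} (p : G.Walk x y) : Prop :=
  p.length = G.dist x y

/-- Thinness condition at corner `v` of a triangle, with sides `p : v → u` and `q : v → u'`. -/
def ThinCorner (G : SimpleGraph V) (δ : ℝ) {v u u' : V}
    (p : G.Walk v u) (q : G.Walk v u') : Prop :=
  ∀ a ∈ p.support, ∀ b ∈ q.support,
    G.dist v a = G.dist v b → (G.dist v a : ℝ) ≤ gp G u u' v →
    (G.dist a b : ℝ) ≤ δ

/-- A geodesic triangle with sides `p : x → y`, `q : y → z`, `r : z → x` is `δ`-thin. -/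
def TriangleThin (G : SimpleGraph V) (δ : ℝ) {x y z : V}
    (p : G.Walk x y) (q : G.Walk y z) (r : G.Walk z x) : Prop :=
  ThinCorner G δ p r.reverse ∧ ThinCorner G δ q p.reverse ∧ ThinCorner G δ r q.reverse

/-- Thinness `τ(G)`: least `δ` such that every geodesic triangle is `δ`-thin. -/
def thinness (G : SimpleGraph V) : ℝ :=
  sInf {δ : ℝ | ∀ (x y z : V) (p : G.Walk x y) (q : G.Walk y z) (r : G.Walk z x),
    IsGeodesic G p → IsGeodesic G q → IsGeodesic G r → TriangleThin G δ p q r}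

/-- The insize `max {d(y_z,z_y), d(z_x,x_z), d(x_y,y_x)}` of a geodesic triangle with
sides `p : x → y`, `q : y → z`, `r : z → x`. -/
def triInsize (G : SimpleGraph V) {x y z : V}
    (p : G.Walk x y) (q : G.Walk y z) (r : G.Walk z x) : ℝ :=
  max (G.dist (p.getVert ⌊gp G y z x⌋₊) (r.reverse.getVert ⌊gp G y z x⌋₊) : ℝ)
    (max (G.dist (q.getVert ⌊gp G z x y⌋₊) (p.reverse.getVert ⌊gp G z x y⌋₊) : ℝ)
      (G.dist (r.getVert ⌊gp G x y z⌋₊) (q.reverse.getVert ⌊gp G x y z⌋₊) : ℝ))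

/-- Insize `ι(G)`: least upper bound on insizes of geodesic triangles. -/
def insize (G : SimpleGraph V) : ℝ :=
  sInf {δ : ℝ | ∀ (x y z : V) (p : G.Walk x y) (q : G.Walk y z) (r : G.Walk z x),
    IsGeodesic G p → IsGeodesic G q → IsGeodesic G r → triInsize G p q r ≤ δ}

/-- A geodesic triangle with sides `p : x → y`, `q : y → z`, `r : z → x` is `δ`-slim. -/
def TriangleSlim (G : SimpleGraph V) (δ : ℝ) {x y z : V}
    (p : G.Walk x y) (q : G.Walk y z) (r : G.Walk z x) : Prop :=
  (∀ a ∈ p.support, ∃ b, (b ∈ q.support ∨ b ∈ r.support) ∧ (G.dist a b : ℝ) ≤ δ) ∧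
  (∀ a ∈ q.support, ∃ b, (b ∈ r.support ∨ b ∈ p.support) ∧ (G.dist a b : ℝ) ≤ δ) ∧
  (∀ a ∈ r.support, ∃ b, (b ∈ p.support ∨ b ∈ q.support) ∧ (G.dist a b : ℝ) ≤ δ)

/-- Slimness `ς(G)`: least `δ` such that every geodesic triangle is `δ`-slim. -/
def slimness (G : SimpleGraph V) : ℝ :=
  sInf {δ : ℝ | ∀ (x y z : V) (p : G.Walk x y) (q : G.Walk y z) (r : G.Walk z x),
    IsGeodesic G p → IsGeodesic G q → IsGeodesic G r → TriangleSlim G δ p q r}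

/-- The metric interval `I(u,v)`. -/
def interval (G : SimpleGraph V) (u v : V) : Set V :=
  {x | G.dist u x + G.dist x v = G.dist u v}

/-- Interval thinness `κ(G)`. -/
def intervalThinness (G : SimpleGraph V) : ℝ :=
  sInf {κ : ℝ | ∀ x y a b : V, a ∈ interval G x y → b ∈ interval G x y →
    G.dist x a = G.dist x b → (G.dist a b : ℝ) ≤ κ}

/-- A BFS-tree of `G` rooted at `w`: a spanning tree (encoded by its parent function)
in which the path from `w` to any vertex is a shortest path of `G`. -/
structure BFSTree (G : SimpleGraph V) (w : V) where
  parent : V → V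
  parent_root : parent w = w
  adj_parent : ∀ x, x ≠ w → G.Adj (parent x) x
  dist_parent : ∀ x, x ≠ w → G.dist w (parent x) + 1 = G.dist w x

/-- The vertex of the tree path `[w,x]_T` at distance `r` from the root `w`
(for `r ≤ d(w,x)`). -/
def treeVert (G : SimpleGraph V) {w : V} (T : BFSTree G w) (x : V) (r : ℕ) : V :=
  T.parent^[G.dist w x - r] x

/-- `v` lies on the tree path `[w,x]_T`. -/
def onRootPath (G : SimpleGraph V) {w : V} (T : BFSTree G w) (x v : V) : Prop :=
  ∃ i ≤ G.dist w x, v = T.parent^[i] x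

/-- The rooted insize `ρ_{w,T}(G) = max {d(x_y, y_x) : x, y ∈ V}`, where `x_y`, `y_x` are
the vertices of `[w,x]_T`, `[w,y]_T` at distance `⌊(x|y)_w⌋` from `w`. -/
def rootedInsize (G : SimpleGraph V) {w : V} (T : BFSTree G w) : ℝ :=
  sSup {ρ : ℝ | ∃ x y : V,
    ρ = (G.dist (treeVert G T x ⌊gp G x y w⌋₊) (treeVert G T y ⌊gp G x y w⌋₊) : ℝ)}

/-- The rooted thinness `μ_{w,T}(G)`. -/
def rootedThinness (G : SimpleGraph V) {w : V} (T : BFSTree G w) : ℝ :=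
  sSup {μ : ℝ | ∃ x y x' y' : V, onRootPath G T x x' ∧ onRootPath G T y y' ∧
    G.dist w x' = G.dist w y' ∧ (G.dist w x' : ℝ) ≤ gp G x y w ∧
    μ = (G.dist x' y' : ℝ)}

section Helpers

variable {G : SimpleGraph V} {w : V}

theorem gp_comm (G : SimpleGraph V) (x y w : V) : gp G x y w = gp G y x w := by
  unfold gp
  rw [G.dist_comm (u := x) (v := y)]
  ring

theorem dist_real_triangle (hG : G.Connected) (x y z : V) :
    (G.dist x z : ℝ) ≤ G.dist x y + G.dist y z :=
  mod_cast hG.dist_triangle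

theorem gp_nonneg (hG : G.Connected) (x y w : V) : 0 ≤ gp G x y w := by
  have h := dist_real_triangle hG x w y
  rw [G.dist_comm (u := w) (v := y)] at h
  unfold gp
  linarith

theorem gp_le_dist (hG : G.Connected) (x y w : V) : gp G x y w ≤ G.dist w x := by
  have h := dist_real_triangle hG y x w
  rw [G.dist_comm (u := y) (v := x)] at h
  rw [G.dist_comm (u := w) (v := x)]
  unfold gp
  linarith

theorem floor_gp_le_dist (hG : G.Connected) (x y w : V) : ⌊gp G x y w⌋₊ ≤ G.dist w x :=
  Nat.floor_le_of_le (gp_le_dist hG x y w)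

theorem gp_sub_dist_le (hG : G.Connected) (p x y w : V) :
    gp G x y w - G.dist p x ≤ gp G p y w := by
  have h₁ := dist_real_triangle hG x p w
  have h₂ := dist_real_triangle hG p x y
  rw [G.dist_comm (u := x) (v := p)] at h₁
  unfold gp
  linarith

namespace BFSTree

theorem dist_iterate_parent (T : BFSTree G w) (x : V) (i : ℕ) :
    G.dist w (T.parent^[i] x) = G.dist w x - i := by
  induction i with
  | zero => simp
  | succ i ih =>
    rw [Function.iterate_succ_apply']
    by_cases h : T.parent^[i] x = w
    · rw [h, SimpleGraph.dist_self] at ih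
      rw [h, T.parent_root, SimpleGraph.dist_self]
      omega
    · have := T.dist_parent _ h
      omega

theorem dist_parent_self_le (T : BFSTree G w) (x : V) : G.dist (T.parent x) x ≤ 1 := by
  by_cases h : x = w
  · rw [h, T.parent_root, SimpleGraph.dist_self]
    exact zero_le_one
  · exact (SimpleGraph.dist_eq_one_iff_adj.mpr (T.adj_parent x h)).le

theorem dist_iterate_parent_self_le (hG : G.Connected) (T : BFSTree G w) (x : V) (i : ℕ) :
    G.dist (T.parent^[i] x) x ≤ i := by
  induction i with
  | zero => simp
  | succ i ih =>
    rw [Function.iterate_succ_apply']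
    have h₁ := T.dist_parent_self_le (T.parent^[i] x)
    have h₂ := hG.dist_triangle (u := T.parent (T.parent^[i] x)) (v := T.parent^[i] x) (w := x)
    omega

end BFSTree

theorem dist_treeVert (T : BFSTree G w) {x : V} {r : ℕ} (hr : r ≤ G.dist w x) :
    G.dist w (treeVert G T x r) = r := by
  rw [treeVert, T.dist_iterate_parent]
  omega

theorem dist_treeVert_self_add_le (hG : G.Connected) (T : BFSTree G w) {x : V} {r : ℕ}
    (hr : r ≤ G.dist w x) : G.dist (treeVert G T x r) x + r ≤ G.dist w x := by
  have := T.dist_iterate_parent_self_le hG x (G.dist w x - r)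
  rw [treeVert]
  omega

theorem treeVert_parent (T : BFSTree G w) {x : V} {r : ℕ} (hr : r < G.dist w x) :
    treeVert G T (T.parent x) r = treeVert G T x r := by
  have hx : x ≠ w := by
    rintro rfl
    simp at hr
  have h := T.dist_parent x hx
  rw [treeVert, treeVert, ← Function.iterate_succ_apply]
  congr 2
  omega

theorem le_gp_treeVert (hG : G.Connected) (T : BFSTree G w) {x : V} {r : ℕ}
    (hr : r ≤ G.dist w x) : (r : ℝ) ≤ gp G (treeVert G T x r) x w := by
  have h₁ : (G.dist w (treeVert G T x r) : ℝ) = r := by exact_mod_cast dist_treeVert T hr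
  have h₂ : (G.dist (treeVert G T x r) x : ℝ) + r ≤ G.dist w x := by
    exact_mod_cast dist_treeVert_self_add_le hG T hr
  unfold gp
  rw [G.dist_comm (v := w), G.dist_comm (u := x)]
  linarith

theorem IsDeltaHyp.dist_treeVert_le {δ : ℝ} (h : IsDeltaHyp G δ) (hG : G.Connected)
    (T : BFSTree G w) (x y : V) :
    (G.dist (treeVert G T x ⌊gp G x y w⌋₊) (treeVert G T y ⌊gp G x y w⌋₊) : ℝ) ≤ 4 * δ := by
  have hδ : 0 ≤ δ := by
    have := h w w w w
    simp only [min_self] at this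
    linarith
  have hx := floor_gp_le_dist hG x y w
  have hy : ⌊gp G x y w⌋₊ ≤ G.dist w y := gp_comm G x y w ▸ floor_gp_le_dist hG y x w
  have hr := Nat.floor_le (gp_nonneg hG x y w)
  set r := ⌊gp G x y w⌋₊
  have dx : (G.dist w (treeVert G T x r) : ℝ) = r := by exact_mod_cast dist_treeVert T hx
  have dy : (G.dist w (treeVert G T y r) : ℝ) = r := by exact_mod_cast dist_treeVert T hy
  have gx := le_gp_treeVert hG T hx
  have gy := le_gp_treeVert hG T hy
  have h₁ := h w (treeVert G T x r) (treeVert G T y r) x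
  have h₂ := h w (treeVert G T y r) x y
  rw [gp_comm G x y w] at hr h₂
  have h₃ : (r : ℝ) ≤ min (gp G (treeVert G T y r) y w) (gp G y x w) := le_min gy hr
  have h₄ : (r : ℝ) - δ ≤
      min (gp G (treeVert G T x r) x w) (gp G (treeVert G T y r) x w) :=
    le_min (by linarith) (by linarith)
  have h₅ : (r : ℝ) - 2 * δ ≤ gp G (treeVert G T x r) (treeVert G T y r) w := by linarith
  unfold gp at h₅
  rw [G.dist_comm (v := w), G.dist_comm (u := treeVert G T y r) (v := w), dx, dy] at h₅
  linarith

/-- A bound on the rooted insize also bounds the distance between the vertices of two root paths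
at any common level below the Gromov product of their ends. -/
theorem dist_treeVert_le_of_le_gp (hG : G.Connected) (T : BFSTree G w) {C : ℝ}
    (hC : ∀ x y : V,
      (G.dist (treeVert G T x ⌊gp G x y w⌋₊) (treeVert G T y ⌊gp G x y w⌋₊) : ℝ) ≤ C)
    (y : V) (r : ℕ) {x : V} (hr : (r : ℝ) ≤ gp G x y w) :
    (G.dist (treeVert G T x r) (treeVert G T y r) : ℝ) ≤ C := by
  induction hn : G.dist w x generalizing x with
  | zero =>
    have h₁ := gp_le_dist hG x y w
    rw [hn, Nat.cast_zero] at h₁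
    have h₂ : ⌊gp G x y w⌋₊ = 0 := Nat.floor_of_nonpos h₁
    have h₃ : r = 0 := by exact_mod_cast le_antisymm (hr.trans h₁) r.cast_nonneg
    rw [h₃, ← h₂]
    exact hC x y
  | succ n ih =>
    by_cases hlt : gp G x y w < r + 1
    · have hfloor : ⌊gp G x y w⌋₊ = r :=
        (Nat.floor_eq_iff (gp_nonneg hG x y w)).mpr ⟨hr, hlt⟩
      rw [← hfloor]
      exact hC x y
    · have hrx : r < G.dist w x := by
        have : (r : ℝ) + 1 ≤ G.dist w x := (not_lt.mp hlt).trans (gp_le_dist hG x y w)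
        exact_mod_cast this
      have hx : x ≠ w := by
        rintro rfl
        simp at hrx
      have hp := T.dist_parent x hx
      have h₁ := gp_sub_dist_le hG (T.parent x) x y w
      have h₂ : (G.dist (T.parent x) x : ℝ) ≤ 1 := by exact_mod_cast T.dist_parent_self_le x
      rw [← treeVert_parent T hrx]
      exact ih (by linarith) (by omega)

theorem sub_le_gp_of_rootedInsize_le (hG : G.Connected) (T : BFSTree G w) {C : ℝ}
    (hC : ∀ x y : V,
      (G.dist (treeVert G T x ⌊gp G x y w⌋₊) (treeVert G T y ⌊gp G x y w⌋₊) : ℝ) ≤ C)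
    (x y z : V) : min (gp G x z w) (gp G y z w) - (C + 1) ≤ gp G x y w := by
  have hm : 0 ≤ min (gp G x z w) (gp G y z w) :=
    le_min (gp_nonneg hG x z w) (gp_nonneg hG y z w)
  have hr := Nat.floor_le hm
  have hr' := Nat.lt_floor_add_one (min (gp G x z w) (gp G y z w))
  set r := ⌊min (gp G x z w) (gp G y z w)⌋₊
  have hx := hr.trans (min_le_left _ _)
  have hy := hr.trans (min_le_right _ _)
  have hrx : r ≤ G.dist w x := by exact_mod_cast hx.trans (gp_le_dist hG x z w)
  have hry : r ≤ G.dist w y := by exact_mod_cast hy.trans (gp_le_dist hG y z w)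
  have h₁ := dist_treeVert_le_of_le_gp hG T hC z r hx
  have h₂ := dist_treeVert_le_of_le_gp hG T hC z r hy
  have h₃ : (G.dist (treeVert G T x r) x : ℝ) + r ≤ G.dist w x := by
    exact_mod_cast dist_treeVert_self_add_le hG T hrx
  have h₄ : (G.dist (treeVert G T y r) y : ℝ) + r ≤ G.dist w y := by
    exact_mod_cast dist_treeVert_self_add_le hG T hry
  have h₅ := dist_real_triangle hG x (treeVert G T x r) y
  have h₆ := dist_real_triangle hG (treeVert G T x r) (treeVert G T z r) y
  have h₇ := dist_real_triangle hG (treeVert G T z r) (treeVert G T y r) y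
  rw [G.dist_comm (u := x) (v := treeVert G T x r)] at h₅
  rw [G.dist_comm (u := treeVert G T z r) (v := treeVert G T y r)] at h₇
  have h₈ : (r : ℝ) - C ≤ gp G x y w := by
    unfold gp
    rw [G.dist_comm (u := x) (v := w), G.dist_comm (u := y) (v := w)]
    linarith
  linarith

/-- The hyperbolicity inequality at one basepoint implies it at every basepoint, with twice the
constant. -/
theorem isDeltaHyp_of_basepoint {δ : ℝ}
    (h : ∀ x y z : V, min (gp G x z w) (gp G y z w) - δ ≤ gp G x y w) :
    IsDeltaHyp G (2 * δ) := by
  have cross : ∀ x y z t : V,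
      min (gp G x z w + gp G y t w) (gp G x t w + gp G y z w) - 2 * δ ≤
        gp G x y w + gp G z t w := by
    intro x y z t
    have h₁ := h x y z
    have h₂ := h x y t
    have h₃ := h z t x
    have h₄ := h z t y
    rw [gp_comm G z x, gp_comm G t x] at h₃
    rw [gp_comm G z y, gp_comm G t y] at h₄
    grind
  intro v x y z
  have hc := cross x y z v
  have e (a b : V) : gp G a b v = gp G a b w - gp G a v w - gp G b v w + G.dist v w := by
    unfold gp
    ring
  rw [ge_iff_le, e x y, e x z, e y z]
  grind

end Helpers

/-- A (possibly infinite) connected graph is hyperbolic (some `δ ≥ 0` works) if and only if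
the rooted insize with respect to any fixed BFS-tree is finite (bounded). -/
theorem hyperbolic_iff_rootedInsize_finite
    {V : Type*} (G : SimpleGraph V) (hG : G.Connected) (w : V) (T : BFSTree G w) :
    (∃ δ : ℝ, 0 ≤ δ ∧ IsDeltaHyp G δ) ↔
      (∃ C : ℝ, ∀ x y : V,
        (G.dist (treeVert G T x ⌊gp G x y w⌋₊) (treeVert G T y ⌊gp G x y w⌋₊) : ℝ) ≤ C) := by
  constructor
  · rintro ⟨δ, -, hδ⟩
    exact ⟨4 * δ, hδ.dist_treeVert_le hG T⟩
  · rintro ⟨C, hC⟩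
    have hC₀ : 0 ≤ C := (Nat.cast_nonneg _).trans (hC w w)
    exact ⟨2 * (C + 1), by positivity,
      isDeltaHyp_of_basepoint (sub_le_gp_of_rootedInsize_le hG T hC)⟩

end HypPaper
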